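/- arXiv:1811.05075 — 2 statements merged into one kernel-verified Lean document; each statement's English description precedes it below -/
import Mathlib

section
/- Assume a ≤ p_n' ≤ b for all n and 2 < inf_n A_n ≤ sup_n A_n < ∞. Then for every x ∈ Y = supp(ν'): liminf_{r→0+} log ν'(B(x,r))/log r = liminf_{n→∞} d(ν',x,n) and limsup_{r→0+} log ν'(B(x,r))/log r = limsup_{n→∞} d(ν',x,n); that is, the lower and upper local dimensions of ν' at x are computed along cylinders. -/
open MeasureTheory Filter Set Metric Topology

/-- `moranCyl c w n (x, ℓ)` refines the interval `[x, x + ℓ]` along the binary word `w`,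
using the contraction ratio `c k` at step `k` (the first letter of `w` is processed with
index `n`).  The result `(x', ℓ')` describes the interval `[x', x' + ℓ']`. -/
noncomputable def moranCyl (c : ℕ → ℝ) : List Bool → ℕ → ℝ × ℝ → ℝ × ℝ
  | [], _, st => st
  | bb :: w, n, st =>
      moranCyl c w (n + 1)
        (if bb then (st.1 + st.2 - st.2 / c n, st.2 / c n) else (st.1, st.2 / c n))

/-- The basic interval `I_w` of the Moran construction with ratios `c`. -/
noncomputable def moranI (c : ℕ → ℝ) (w : List Bool) : Set ℝ :=
  Icc (moranCyl c w 1 (0, 1)).1 ((moranCyl c w 1 (0, 1)).1 + (moranCyl c w 1 (0, 1)).2)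

/-- The length `|I_w|` of the basic interval `I_w`. -/
noncomputable def moranLen (c : ℕ → ℝ) (w : List Bool) : ℝ :=
  (moranCyl c w 1 (0, 1)).2

/-- The Moran set `⋂ n ⋃ {I_w : |w| = n}`. -/
noncomputable def moranSet (c : ℕ → ℝ) : Set ℝ :=
  ⋂ n : ℕ, ⋃ w ∈ {w : List Bool | w.length = n}, moranI c w

/-- The mass assigned to the cylinder `I_w` by the Moran measure with weight `r k` for the
letter at step `k`: `cylMass r w 1 1 = μ(I_w)`. -/
noncomputable def cylMass (r : ℕ → ℝ) : List Bool → ℕ → ℝ → ℝ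
  | [], _, m => m
  | bb :: w, n, m => cylMass r w (n + 1) (if bb then (1 - r n) * m else r n * m)

/-- Lower local dimension `liminf_{r → 0⁺} log μ(B(x,r)) / log r`. -/
noncomputable def lowerLocalDim (μ : Measure ℝ) (x : ℝ) : ℝ :=
  liminf (fun rr : ℝ => Real.log (μ (closedBall x rr)).toReal / Real.log rr) (𝓝[>] 0)

/-- Upper local dimension `limsup_{r → 0⁺} log μ(B(x,r)) / log r`. -/
noncomputable def upperLocalDim (μ : Measure ℝ) (x : ℝ) : ℝ :=
  limsup (fun rr : ℝ => Real.log (μ (closedBall x rr)).toReal / Real.log rr) (𝓝[>] 0)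

/-- `betaFn ρ C s = -log (ρ^s + (1-ρ)^s) / log C`; so `β₁ = betaFn p A`, `β₂ = betaFn q B`. -/
noncomputable def betaFn (ρ C : ℝ) (s : ℝ) : ℝ :=
  -Real.log (ρ ^ s + (1 - ρ) ^ s) / Real.log C

/-- The Legendre transform `f^*(α) = inf_s (s α - f(s))`. -/
noncomputable def legendre (f : ℝ → ℝ) (α : ℝ) : ℝ :=
  ⨅ s : ℝ, (s * α - f s)

/-- The modification `β̃₁` of `β₁`, linear on `(0,1)`. -/
noncomputable def betaTilde1 (ρ C : ℝ) (s : ℝ) : ℝ :=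
  if s ≤ 0 ∨ 1 ≤ s then betaFn ρ C s
  else (1 - s) * betaFn ρ C 0 + s * betaFn ρ C 1

/-- `packSup μ X r s` is the supremum of `∑ᵢ μ(B(xᵢ,r))^s` over all finite families of
pairwise disjoint closed balls of radius `r` with centers in `X`. -/
noncomputable def packSup (μ : Measure ℝ) (X : Set ℝ) (rr s : ℝ) : ℝ :=
  sSup {y : ℝ | ∃ t : Finset ℝ, (↑t : Set ℝ) ⊆ X ∧
    (↑t : Set ℝ).Pairwise (fun u v => Disjoint (closedBall u rr) (closedBall v rr)) ∧
    y = ∑ u ∈ t, (μ (closedBall u rr)).toReal ^ s}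

section FilterComparison

variable {α β : Type*} {F : Filter α} {G : Filter β} {u ε : α → ℝ} {v : β → ℝ} {φ : α → β}

/-- If `u` is eventually bounded below by `v ∘ φ` up to an error tending to zero, and `φ` tends
to `G` along `F`, then the liminf of `u` dominates that of `v`. -/
lemma liminf_le_liminf_of_tendsto [F.NeBot] (hφ : Tendsto φ F G) (hε : Tendsto ε F (𝓝 0))
    (h : ∀ᶠ x in F, v (φ x) - ε x ≤ u x)
    (hv : G.IsBoundedUnder (· ≥ ·) v) (hu : F.IsBoundedUnder (· ≤ ·) u) :
    liminf v G ≤ liminf u F := by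
  refine le_of_forall_lt fun c hc => ?_
  obtain ⟨c₁, hc₁, hc₁'⟩ := exists_between hc
  obtain ⟨c₂, hc₂, hc₂'⟩ := exists_between hc₁
  refine hc₂.trans_le (le_liminf_of_le hu.isCoboundedUnder_ge ?_)
  filter_upwards [h, hφ.eventually (eventually_lt_of_lt_liminf hc₁' hv),
    hε.eventually (gt_mem_nhds (sub_pos.2 hc₂'))] with x h₁ h₂ h₃
  linarith

/-- If `u` is eventually bounded above by `v ∘ φ` up to an error tending to zero, and `φ` tends
to `G` along `F`, then the limsup of `v` dominates that of `u`. -/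
lemma limsup_le_limsup_of_tendsto [F.NeBot] (hφ : Tendsto φ F G) (hε : Tendsto ε F (𝓝 0))
    (h : ∀ᶠ x in F, u x ≤ v (φ x) + ε x)
    (hv : G.IsBoundedUnder (· ≤ ·) v) (hu : F.IsBoundedUnder (· ≥ ·) u) :
    limsup u F ≤ limsup v G := by
  refine le_of_forall_gt fun c hc => ?_
  obtain ⟨c₁, hc₁, hc₁'⟩ := exists_between hc
  obtain ⟨c₂, hc₂, hc₂'⟩ := exists_between hc₁'
  refine (limsup_le_of_le hu.isCoboundedUnder_le ?_).trans_lt hc₂'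
  filter_upwards [h, hφ.eventually (eventually_lt_of_limsup_lt hc₁ hv),
    hε.eventually (gt_mem_nhds (sub_pos.2 hc₂))] with x h₁ h₂ h₃
  linarith

end FilterComparison

section ScaleComparison

lemma div_sub_le_div_add {g l C K : ℝ} (hl : 0 < l) (hC : 0 ≤ C) (hK : 0 ≤ K)
    (hg : g ≤ K * l) : g / l - K * C / l ≤ g / (l + C) := by
  rw [← sub_div, div_le_div_iff₀ hl (by positivity)]
  nlinarith [mul_le_mul_of_nonneg_right hg hC, mul_nonneg hK (mul_nonneg hC hC)]

lemma div_sub_le_add_div {g l C K : ℝ} (hC : 0 ≤ C) (hCl : C < l) (hg : g ≤ K * l) :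
    g / (l - C) ≤ g / l + K * C / (l - C) := by
  have hl : 0 < l := hC.trans_lt hCl
  rw [← sub_le_iff_le_add, ← sub_div, div_le_div_iff₀ (sub_pos.2 hCl) hl]
  nlinarith [mul_le_mul_of_nonneg_right hg hC]

variable {L μ : ℕ → ℝ} {m : ℝ → ℝ} {c K M : ℝ}

lemma le_div_two_pow (hhalf : ∀ n, L (n + 1) ≤ L n / 2) (n k : ℕ) :
    L (n + k) ≤ L n / 2 ^ k := by
  induction k with
  | zero => simp
  | succ k ih =>
    calc L (n + k + 1) ≤ L (n + k) / 2 := hhalf _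
      _ ≤ L n / 2 ^ k / 2 := by gcongr
      _ = L n / 2 ^ (k + 1) := by rw [pow_succ]; field_simp

lemma antitone_of_le_half (hpos : ∀ n, 0 < L n) (hhalf : ∀ n, L (n + 1) ≤ L n / 2) :
    Antitone L :=
  antitone_nat_of_succ_le fun n => (hhalf n).trans (half_le_self (hpos n).le)

lemma tendsto_zero_of_le_half (hpos : ∀ n, 0 < L n) (hhalf : ∀ n, L (n + 1) ≤ L n / 2) :
    Tendsto L atTop (𝓝 0) := by
  refine squeeze_zero (fun n => (hpos n).le) (fun n => ?_)
    (tendsto_const_nhds.div_atTop (tendsto_pow_atTop_atTop_of_one_lt one_lt_two) :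
      Tendsto (fun n : ℕ => L 0 / (2 : ℝ) ^ n) atTop (𝓝 0))
  simpa using le_div_two_pow hhalf 0 n

lemma exists_scale (hpos : ∀ n, 0 < L n) (hhalf : ∀ n, L (n + 1) ≤ L n / 2) {r : ℝ}
    (hr : 0 < r) (hr0 : r ≤ L 0) : ∃ n, L (n + 1) < r ∧ r ≤ L n := by
  by_contra! h
  have : ∀ n, r ≤ L n := fun n => by
    induction n with
    | zero => exact hr0
    | succ n ih => exact not_lt.1 fun h' => (h n h').not_ge ih
  exact hr.not_ge (ge_of_tendsto' (tendsto_zero_of_le_half hpos hhalf) this)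

/-- If a monotone function `m` of the radius is compared with a sequence `μ` along the scales
`L n` (up to a multiplicative constant `c`), then the lower and upper exponents of `m` at zero are
those of `μ` along the scales. -/
theorem exponents_eq_of_scales (hpos : ∀ n, 0 < L n) (hhalf : ∀ n, L (n + 1) ≤ L n / 2)
    (hL0 : L 0 = 1) (hLM : ∀ n, L n ≤ M * L (n + 1)) (hM : 1 ≤ M) (hc : 0 < c) (hc1 : c ≤ 1)
    (hm : Monotone m) (hm1 : ∀ r, m r ≤ 1) (hμ : ∀ n, 0 < μ n) (hμm : ∀ n, μ n ≤ m (L n))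
    (hmμ : ∀ n, m (c * L n) ≤ μ n) (hK : 0 ≤ K)
    (hμK : ∀ n, -Real.log (μ n) ≤ K * -Real.log (L n)) :
    liminf (fun r => Real.log (m r) / Real.log r) (𝓝[>] 0) =
        liminf (fun n => Real.log (μ n) / Real.log (L n)) atTop ∧
      limsup (fun r => Real.log (m r) / Real.log r) (𝓝[>] 0) =
        limsup (fun n => Real.log (μ n) / Real.log (L n)) atTop := by
  have hanti := antitone_of_le_half hpos hhalf
  have hzero := tendsto_zero_of_le_half hpos hhalf
  have hposc : ∀ n, 0 < c * L n := fun n => mul_pos hc (hpos n)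
  have hmpos : ∀ r, 0 < r → 0 < m r := fun r hr => by
    obtain ⟨n, hn⟩ := (hzero.eventually (gt_mem_nhds hr)).exists
    exact (hμ n).trans_le ((hμm n).trans (hm hn.le))
  have hμ1 : ∀ n, μ n ≤ 1 := fun n => (hμm n).trans (hm1 _)
  set l : ℕ → ℝ := fun n => -Real.log (L n) with hl
  set g : ℕ → ℝ := fun n => -Real.log (μ n) with hg
  set f : ℝ → ℝ := fun r => -Real.log (m r) with hf
  have hd : (fun n => Real.log (μ n) / Real.log (L n)) = fun n => g n / l n := by
    funext n; simp only [hl, hg, neg_div_neg_eq]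
  have hF : (fun r => Real.log (m r) / Real.log r) = fun r => f r / -Real.log r := by
    funext r; simp only [hf, neg_div_neg_eq]
  rw [hd, hF]
  have hg0 : ∀ n, 0 ≤ g n := fun n => neg_nonneg.2 (Real.log_nonpos (hμ n).le (hμ1 n))
  have hf0 : ∀ r, 0 < r → 0 ≤ f r := fun r hr =>
    neg_nonneg.2 (Real.log_nonpos (hmpos r hr).le (hm1 r))
  have hLt : Tendsto L atTop (𝓝[>] 0) :=
    tendsto_nhdsWithin_iff.2 ⟨hzero, Eventually.of_forall hpos⟩
  have hcLt : Tendsto (fun n => c * L n) atTop (𝓝[>] 0) :=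
    tendsto_nhdsWithin_iff.2 ⟨by simpa using hzero.const_mul c, Eventually.of_forall hposc⟩
  have hlt : Tendsto l atTop atTop :=
    tendsto_neg_atBot_atTop.comp (Real.tendsto_log_nhdsGT_zero.comp hLt)
  set C := -Real.log c with hC
  have hC0 : 0 ≤ C := neg_nonneg.2 (Real.log_nonpos hc.le hc1)
  have hlogc : ∀ n, -Real.log (c * L n) = l n + C := fun n => by
    rw [Real.log_mul hc.ne' (hpos n).ne']; simp only [hl, hC]; ring
  set D := Real.log M with hD
  have hD0 : 0 ≤ D := Real.log_nonneg hM
  have hlD : ∀ n, l (n + 1) ≤ l n + D := fun n => by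
    have := Real.log_le_log (hpos n) (hLM n)
    rw [Real.log_mul (by positivity) (hpos _).ne'] at this
    simp only [hl, hD]; linarith
  have hlDk : ∀ n k : ℕ, l (n + k) ≤ l n + k * D := fun n k => by
    induction k with
    | zero => simp
    | succ k ih => have := hlD (n + k); rw [← add_assoc]; push_cast; linarith
  obtain ⟨k, hk⟩ : ∃ k : ℕ, (1 / 2 : ℝ) ^ k < c := exists_pow_lt_of_lt_one hc (by norm_num)
  have hLk : ∀ n, L (n + k) ≤ c * L n := fun n => by
    refine (le_div_two_pow hhalf n k).trans ?_
    calc L n / 2 ^ k = (1 / 2) ^ k * L n := by rw [one_div, inv_pow]; field_simp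
      _ ≤ c * L n := by gcongr; exact (hpos n).le
  -- the scale of a radius
  have hscale : ∀ r, ∃ n, 0 < r → r ≤ c → c * L (n + 1) < r ∧ r ≤ c * L n := fun r => by
    by_cases h : 0 < r ∧ r ≤ c
    · obtain ⟨n, hn⟩ := exists_scale (L := fun n => c * L n) hposc
        (fun n => by have := hhalf n; rw [mul_div_assoc]; gcongr) h.1 (by simpa [hL0] using h.2)
      exact ⟨n, fun _ _ => hn⟩
    · exact ⟨0, fun h₁ h₂ => (h ⟨h₁, h₂⟩).elim⟩
  choose N hN using hscale
  have hsmall : ∀ t : ℝ, 0 < t → ∀ᶠ r in 𝓝[>] (0 : ℝ), 0 < r ∧ r < t := fun t ht =>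
    Ioo_mem_nhdsGT ht
  have hNt : Tendsto N (𝓝[>] 0) atTop := by
    refine tendsto_atTop.2 fun j => ?_
    filter_upwards [hsmall c hc, hsmall _ (hposc j)] with r hr hr'
    by_contra! hlt'
    have h₁ := (hN r hr.1 hr.2.le).1
    have h₂ := mul_le_mul_of_nonneg_left (hanti (Nat.succ_le_of_lt hlt')) hc.le
    exact absurd hr'.2 (not_lt.2 (h₂.trans h₁.le))
  have herr : ∀ B : ℝ, Tendsto (fun n => B / l n) atTop (𝓝 0) := fun B =>
    tendsto_const_nhds.div_atTop hlt
  have hlpos : ∀ B, ∀ᶠ n in atTop, B < l n := fun B => hlt.eventually_gt_atTop B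
  set E := ((k + 1 : ℕ) : ℝ) * D with hE
  have hE0 : 0 ≤ E := by positivity
  have herrE : Tendsto (fun n => K * E / (l n - E)) atTop (𝓝 0) :=
    tendsto_const_nhds.div_atTop (tendsto_atTop_add_const_right _ (-E) hlt)
  have hN't : Tendsto (fun r => N r + (k + 1)) (𝓝[>] 0) atTop :=
    (tendsto_add_atTop_nat (k + 1)).comp hNt
  have hlow : ∀ᶠ r in 𝓝[>] (0 : ℝ),
      g (N r) / l (N r) - K * (C + D) / l (N r) ≤ f r / -Real.log r := by
    filter_upwards [hsmall c hc, hsmall 1 one_pos, hNt.eventually (hlpos 0)] with r hr hr1 hl0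
    obtain ⟨h₁, h₂⟩ := hN r hr.1 hr.2.le
    have hgf : g (N r) ≤ f r :=
      neg_le_neg (Real.log_le_log (hmpos r hr.1) ((hm h₂).trans (hmμ _)))
    have hlog : -Real.log r ≤ l (N r) + (C + D) := by
      have := Real.log_le_log (hposc _) h₁.le
      have := hlogc (N r + 1)
      have := hlD (N r)
      linarith
    refine (div_sub_le_div_add hl0 (by positivity) hK (hμK _)).trans ?_
    exact div_le_div₀ (hf0 r hr.1) hgf (neg_pos.2 (Real.log_neg hr1.1 hr1.2)) hlog
  have hupp : ∀ᶠ r in 𝓝[>] (0 : ℝ),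
      f r / -Real.log r ≤
        g (N r + (k + 1)) / l (N r + (k + 1)) + K * E / (l (N r + (k + 1)) - E) := by
    filter_upwards [hsmall c hc, hN't.eventually (hlpos E)] with r hr hlE
    obtain ⟨h₁, h₂⟩ := hN r hr.1 hr.2.le
    have hle : L (N r + (k + 1)) ≤ r := by
      have := hLk (N r + 1)
      rw [show N r + (k + 1) = N r + 1 + k by ring]
      linarith
    have hfg : f r ≤ g (N r + (k + 1)) :=
      neg_le_neg (Real.log_le_log (hμ _) ((hμm _).trans (hm hle)))
    have hlog : l (N r + (k + 1)) - E ≤ -Real.log r := by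
      have := Real.log_le_log hr.1 h₂
      have := hlogc (N r)
      have := hlDk (N r) (k + 1)
      linarith
    refine le_trans ?_ (div_sub_le_add_div hE0 hlE (hμK _))
    exact div_le_div₀ (hg0 _) hfg (sub_pos.2 hlE) hlog
  have hdle : ∀ᶠ n in atTop, g n / l n ≤ K := by
    filter_upwards [hlpos 0] with n hn using (div_le_iff₀ hn).2 (hμK n)
  have hdge : ∀ᶠ n in atTop, 0 ≤ g n / l n := by
    filter_upwards [hlpos 0] with n hn using div_nonneg (hg0 n) hn.le
  have hFge : ∀ᶠ r in 𝓝[>] (0 : ℝ), 0 ≤ f r / -Real.log r := by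
    filter_upwards [hsmall 1 one_pos] with r hr
    exact div_nonneg (hf0 r hr.1) (neg_nonneg.2 (Real.log_nonpos hr.1.le hr.2.le))
  have hFle : ∀ᶠ r in 𝓝[>] (0 : ℝ), f r / -Real.log r ≤ K + 1 := by
    filter_upwards [hupp, hN't.eventually hdle,
      hN't.eventually (herrE.eventually (gt_mem_nhds one_pos))] with r h₁ h₂ h₃
    linarith
  have hbd : IsBoundedUnder (· ≤ ·) atTop fun n => g n / l n := ⟨K, by simpa using hdle⟩
  have hbd' : IsBoundedUnder (· ≥ ·) atTop fun n => g n / l n := ⟨0, by simpa using hdge⟩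
  have hbF : IsBoundedUnder (· ≤ ·) (𝓝[>] (0 : ℝ)) fun r => f r / -Real.log r :=
    ⟨K + 1, by simpa only [eventually_map] using hFle⟩
  have hbF' : IsBoundedUnder (· ≥ ·) (𝓝[>] (0 : ℝ)) fun r => f r / -Real.log r :=
    ⟨0, by simpa only [eventually_map] using hFge⟩
  refine ⟨le_antisymm ?_ ?_, le_antisymm ?_ ?_⟩
  · refine liminf_le_liminf_of_tendsto hLt (tendsto_const_nhds (x := (0 : ℝ))) ?_ hbF' hbd
    filter_upwards [hlpos 0] with n hn
    rw [sub_zero]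
    exact div_le_div_of_nonneg_right (neg_le_neg (Real.log_le_log (hμ n) (hμm n))) hn.le
  · exact liminf_le_liminf_of_tendsto hNt ((herr (K * (C + D))).comp hNt) hlow hbd' hbF
  · exact limsup_le_limsup_of_tendsto hN't (herrE.comp hN't) hupp hbd hbF'
  · refine limsup_le_limsup_of_tendsto hcLt (herr (K * C)) ?_ hbF hbd'
    filter_upwards [hlpos 0] with n hn
    rw [← sub_le_iff_le_add]
    refine (div_sub_le_div_add hn hC0 hK (hμK n)).trans ?_
    rw [hlogc n]
    exact div_le_div_of_nonneg_right
      (neg_le_neg (Real.log_le_log (hmpos _ (hposc n)) (hmμ n))) (by positivity)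

end ScaleComparison

section MoranGeometry

variable {A : ℕ → ℝ}

lemma moranCyl_snd (w : List Bool) (n : ℕ) (st : ℝ × ℝ) :
    (moranCyl A w n st).2 = st.2 * ∏ k ∈ Finset.range w.length, (A (n + k))⁻¹ := by
  induction w generalizing n st with
  | nil => simp [moranCyl]
  | cons b w ih =>
    rw [moranCyl, ih, List.length_cons, Finset.prod_range_succ']
    have : ∀ k, n + 1 + k = n + (k + 1) := fun k => by ring
    cases b <;> simp [this, div_eq_mul_inv] <;> ring

lemma moranLen_eq_prod (w : List Bool) :
    moranLen A w = ∏ k ∈ Finset.range w.length, (A (1 + k))⁻¹ := by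
  simp [moranLen, moranCyl_snd]

lemma moranCyl_bounds (hA : ∀ n, 2 ≤ A n) (w : List Bool) (n : ℕ) (st : ℝ × ℝ)
    (hst : 0 ≤ st.2) :
    st.1 ≤ (moranCyl A w n st).1 ∧
      (moranCyl A w n st).1 + (moranCyl A w n st).2 ≤ st.1 + st.2 ∧
      0 ≤ (moranCyl A w n st).2 := by
  induction w generalizing n st with
  | nil => simpa [moranCyl] using hst
  | cons b w ih =>
    have h0 : 0 ≤ st.2 / A n := div_nonneg hst (by linarith [hA n])
    have h1 : st.2 / A n ≤ st.2 := div_le_self hst (by linarith [hA n])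
    cases b
    · obtain ⟨h₂, h₃, h₄⟩ := ih (n + 1) (st.1, st.2 / A n) h0
      simp only [moranCyl, Bool.false_eq_true, if_false]
      exact ⟨h₂, h₃.trans (by simpa using h1), h₄⟩
    · obtain ⟨h₂, h₃, h₄⟩ := ih (n + 1) (st.1 + st.2 - st.2 / A n, st.2 / A n) h0
      simp only [moranCyl, if_true]
      exact ⟨le_trans (by linarith) h₂, by simpa using h₃, h₄⟩

/-- Points of distinct basic intervals of the same level are separated by a fixed proportion of
the length of these intervals. -/
lemma moranCyl_gap {q c : ℝ} (hA : ∀ n, 2 ≤ A n) (hq : 0 < q) (hqA : ∀ n, q ≤ A n)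
    (hc0 : 0 ≤ c) (hc : c < 1 - 2 / q) (v w : List Bool) (hvw : v.length = w.length) (hne : v ≠ w)
    (n : ℕ) (st : ℝ × ℝ) (hst : 0 < st.2) {x y : ℝ}
    (hx : x ∈ Icc (moranCyl A v n st).1 ((moranCyl A v n st).1 + (moranCyl A v n st).2))
    (hy : y ∈ Icc (moranCyl A w n st).1 ((moranCyl A w n st).1 + (moranCyl A w n st).2)) :
    c * (moranCyl A v n st).2 < |x - y| := by
  induction v generalizing w n st with
  | nil => exact (hne (List.length_eq_zero_iff.1 hvw.symm).symm).elim
  | cons b v ih =>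
    cases w with
    | nil => simp at hvw
    | cons d w =>
      have hAn : 0 < A n := hq.trans_le (hqA n)
      have hpos : 0 < st.2 / A n := div_pos hst hAn
      have hgap : c * (st.2 / A n) < st.2 - 2 * (st.2 / A n) := by
        have h₁ : st.2 / A n ≤ st.2 / q := by gcongr; exact hqA n
        have h₂ : c * (st.2 / A n) ≤ c * st.2 := by
          gcongr
          exact div_le_self hst.le (by linarith [hA n])
        have h₃ : c * st.2 < (1 - 2 / q) * st.2 := by gcongr
        have h₄ : (1 - 2 / q) * st.2 = st.2 - 2 * (st.2 / q) := by ring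
        linarith
      cases b <;> cases d <;>
        simp only [moranCyl, Bool.false_eq_true, if_false, if_true] at hx hy ⊢
      · exact ih w (by simpa using hvw) (by simpa using hne) _ _ hpos hx hy
      · obtain ⟨h₁, h₂, h₃⟩ := moranCyl_bounds hA v (n + 1) (st.1, st.2 / A n) hpos.le
        obtain ⟨h₄, h₅, h₆⟩ := moranCyl_bounds hA w (n + 1)
          (st.1 + st.2 - st.2 / A n, st.2 / A n) hpos.le
        have h₇ := mul_le_mul_of_nonneg_left
          (show (moranCyl A v (n + 1) (st.1, st.2 / A n)).2 ≤ st.2 / A n by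
            simp only at h₁ h₂; linarith) hc0
        rw [abs_sub_comm]
        refine lt_of_lt_of_le ?_ (le_abs_self _)
        simp only at h₁ h₂ h₄ h₅
        linarith [hx.2, hy.1]
      · obtain ⟨h₁, h₂, h₃⟩ := moranCyl_bounds hA v (n + 1)
          (st.1 + st.2 - st.2 / A n, st.2 / A n) hpos.le
        obtain ⟨h₄, h₅, h₆⟩ := moranCyl_bounds hA w (n + 1) (st.1, st.2 / A n) hpos.le
        have h₇ := mul_le_mul_of_nonneg_left
          (show (moranCyl A v (n + 1) (st.1 + st.2 - st.2 / A n, st.2 / A n)).2 ≤ st.2 / A n by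
            simp only at h₁ h₂; linarith) hc0
        refine lt_of_lt_of_le ?_ (le_abs_self _)
        simp only at h₁ h₂ h₄ h₅
        linarith [hx.1, hy.2]
      · exact ih w (by simpa using hvw) (by simpa using hne) _ _ hpos hx hy

end MoranGeometry

section MoranMass

/-- The finite set of binary words of length `n`. -/
def binaryWords : ℕ → Finset (List Bool)
  | 0 => {[]}
  | n + 1 => ((Finset.univ : Finset Bool) ×ˢ binaryWords n).image fun t => t.1 :: t.2

lemma mem_binaryWords {n : ℕ} {w : List Bool} : w ∈ binaryWords n ↔ w.length = n := by
  induction n generalizing w with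
  | zero => simp [binaryWords]
  | succ n ih => cases w <;> simp [binaryWords, ih]

lemma sum_cylMass (r : ℕ → ℝ) (n k : ℕ) (t : ℝ) :
    ∑ w ∈ binaryWords n, cylMass r w k t = t := by
  induction n generalizing k t with
  | zero => simp [binaryWords, cylMass]
  | succ n ih =>
    rw [binaryWords, Finset.sum_image (by rintro ⟨a, b⟩ _ ⟨c, d⟩ _ h; simpa using h),
      Finset.sum_product]
    simp only [cylMass, ih, Fintype.sum_bool, if_true, Bool.false_eq_true, if_false]
    ring

lemma pow_mul_le_cylMass {r : ℕ → ℝ} {δ : ℝ} (hδ : 0 ≤ δ) (h : ∀ n, δ ≤ r n)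
    (h' : ∀ n, δ ≤ 1 - r n) (w : List Bool) (n : ℕ) {t : ℝ} (ht : 0 ≤ t) :
    δ ^ w.length * t ≤ cylMass r w n t := by
  induction w generalizing n t with
  | nil => simp [cylMass]
  | cons b w ih =>
    have key : ∀ s, δ ≤ s → δ ^ (w.length + 1) * t ≤ cylMass r w (n + 1) (s * t) := fun s hs => by
      refine le_trans ?_ (ih (n + 1) (mul_nonneg (hδ.trans hs) ht))
      rw [pow_succ, mul_assoc]
      gcongr
    cases b
    · simpa [cylMass] using key _ (h n)
    · simpa [cylMass] using key _ (h' n)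

end MoranMass

section MoranMeasure

variable {A r : ℕ → ℝ} {μ : Measure ℝ} [IsProbabilityMeasure μ] {q c : ℝ}

/-- A Moran measure is carried by the basic intervals of each level. -/
lemma measure_compl_moranLevel (hA : ∀ n, 2 ≤ A n) (hq : 2 < q) (hqA : ∀ n, q ≤ A n)
    (hnonneg : ∀ w, 0 ≤ cylMass r w 1 1)
    (hμ : ∀ w, μ (moranI A w) = ENNReal.ofReal (cylMass r w 1 1)) (n : ℕ) :
    μ (⋃ w ∈ binaryWords n, moranI A w)ᶜ = 0 := by
  have hmeas : ∀ w, MeasurableSet (moranI A w) := fun _ => measurableSet_Icc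
  rw [prob_compl_eq_zero_iff (Finset.measurableSet_biUnion _ fun w _ => hmeas w),
    measure_biUnion_finset ?_ fun w _ => hmeas w]
  · simp_rw [hμ]
    rw [← ENNReal.ofReal_sum_of_nonneg fun w _ => hnonneg w, sum_cylMass, ENNReal.ofReal_one]
  · intro v hv w hw hne
    refine Set.disjoint_left.2 fun x hxv hxw => ?_
    have := moranCyl_gap hA (two_pos.trans hq) hqA le_rfl
      (sub_pos.2 ((div_lt_one (two_pos.trans hq)).2 hq)) v w
      ((mem_binaryWords.1 hv).trans (mem_binaryWords.1 hw).symm) hne 1 (0, 1) one_pos hxv hxw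
    simp at this

/-- A ball of radius a small proportion of `|I_w|` centred in `I_w` has no more mass than
`I_w`. -/
lemma measure_closedBall_le (hA : ∀ n, 2 ≤ A n) (hq : 2 < q) (hqA : ∀ n, q ≤ A n)
    (hc0 : 0 ≤ c) (hc : c < 1 - 2 / q) (hnonneg : ∀ w, 0 ≤ cylMass r w 1 1)
    (hμ : ∀ w, μ (moranI A w) = ENNReal.ofReal (cylMass r w 1 1)) {w : List Bool} {x : ℝ}
    (hx : x ∈ moranI A w) : μ (closedBall x (c * moranLen A w)) ≤ μ (moranI A w) := by
  have hsub : closedBall x (c * moranLen A w) ⊆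
      moranI A w ∪ (⋃ v ∈ binaryWords w.length, moranI A v)ᶜ := by
    intro y hy
    by_contra hcon
    simp only [Set.mem_union, not_or, Set.mem_compl_iff, not_not, Set.mem_iUnion] at hcon
    obtain ⟨hyw, v, hv, hyv⟩ := hcon
    have := moranCyl_gap hA (two_pos.trans hq) hqA hc0 hc w v (mem_binaryWords.1 hv).symm
      (fun h => hyw (h ▸ hyv)) 1 (0, 1) one_pos hx hyv
    rw [mem_closedBall, Real.dist_eq, abs_sub_comm] at hy
    exact hy.not_gt this
  refine (measure_mono hsub).trans ((measure_union_le _ _).trans ?_)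
  rw [measure_compl_moranLevel hA hq hqA hnonneg hμ, add_zero]

lemma moranI_subset_closedBall {w : List Bool} {x : ℝ} (hx : x ∈ moranI A w) :
    moranI A w ⊆ closedBall x (moranLen A w) := by
  intro y hy
  rw [moranI, Set.mem_Icc] at hx hy
  rw [mem_closedBall, Real.dist_eq, abs_le, moranLen]
  constructor <;> linarith [hx.1, hx.2, hy.1, hy.2]

end MoranMeasure

/-- assume a ≤ p'_n ≤ b and 2 < inf_n A_n ≤ sup_n A_n < ∞.  Then for every
x ∈ Y = supp(ν'), the lower and upper local dimensions of ν' at x are computed along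
cylinders: liminf_{r→0+} log ν'(B(x,r))/log r = liminf_n d(ν',x,n), and likewise for
the limsup, where I_n(x) = I_{W n} is any level-n cylinder chain containing x. -/
theorem stmt_17 (A : ℕ → ℝ) (a b : ℝ) (p p' : ℕ → ℝ)
    (hA : ∀ n : ℕ, 2 ≤ A n)
    (ha0 : 0 < a) (hab : a ≤ b) (hb1 : b < 1)
    (hp : ∀ n : ℕ, a ≤ p n ∧ p n ≤ b)
    (hp' : ∀ n : ℕ, a ≤ p' n ∧ p' n ≤ b)
    (hinf : 2 < ⨅ n : ℕ, A n) (hbdd : BddAbove (Set.range A))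
    (ν ν' : Measure ℝ) [IsProbabilityMeasure ν] [IsProbabilityMeasure ν']
    (hν : ∀ w : List Bool, ν (moranI A w) = ENNReal.ofReal (cylMass p w 1 1))
    (hν' : ∀ w : List Bool, ν' (moranI A w) = ENNReal.ofReal (cylMass p' w 1 1))
    (x : ℝ) (hx : x ∈ moranSet A) (W : ℕ → List Bool)
    (hW : ∀ n : ℕ, (W n).length = n ∧ x ∈ moranI A (W n)) :
    lowerLocalDim ν' x =
      liminf (fun n : ℕ =>
        Real.log (ν' (moranI A (W n))).toReal / Real.log (moranLen A (W n))) atTop ∧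
    upperLocalDim ν' x =
      limsup (fun n : ℕ =>
        Real.log (ν' (moranI A (W n))).toReal / Real.log (moranLen A (W n))) atTop := by
  set q := ⨅ n, A n with hq
  have hqA : ∀ n, q ≤ A n := fun n => ciInf_le ⟨2, by rintro _ ⟨n, rfl⟩; exact hA n⟩ n
  obtain ⟨M, hM⟩ := hbdd
  have hAM : ∀ n, A n ≤ M := fun n => hM ⟨n, rfl⟩
  have hApos : ∀ n, 0 < A n := fun n => two_pos.trans_le (hA n)
  set L : ℕ → ℝ := fun n => ∏ k ∈ Finset.range n, (A (1 + k))⁻¹ with hL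
  have hLW : ∀ n, moranLen A (W n) = L n := fun n => by rw [moranLen_eq_prod, (hW n).1]
  have hLpos : ∀ n, 0 < L n := fun n => Finset.prod_pos fun k _ => inv_pos.2 (hApos _)
  have hLsucc : ∀ n, L (n + 1) = L n / A (1 + n) := fun n => by
    simp only [hL, Finset.prod_range_succ, div_eq_mul_inv]
  have hhalf : ∀ n, L (n + 1) ≤ L n / 2 := fun n => by
    rw [hLsucc]
    exact div_le_div_of_nonneg_left (hLpos n).le two_pos (hA _)
  have hLM : ∀ n, L n ≤ M * L (n + 1) := fun n => by
    rw [hLsucc, mul_div_assoc', le_div_iff₀ (hApos _), mul_comm]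
    exact mul_le_mul_of_nonneg_right (hAM _) (hLpos n).le
  set δ := min a (1 - b) with hδ
  have hδ0 : 0 < δ := lt_min ha0 (sub_pos.2 hb1)
  have hδ1 : δ ≤ 1 := (min_le_left _ _).trans (hab.trans hb1.le)
  have hmass : ∀ w, δ ^ w.length ≤ cylMass p' w 1 1 := fun w => by
    simpa using pow_mul_le_cylMass hδ0.le (fun n => (min_le_left _ _).trans (hp' n).1)
      (fun n => (min_le_right _ _).trans (by linarith [(hp' n).2])) w 1 zero_le_one
  have hnonneg : ∀ w, 0 ≤ cylMass p' w 1 1 := fun w => (pow_nonneg hδ0.le _).trans (hmass w)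
  have hmassW : ∀ n, δ ^ n ≤ (ν' (moranI A (W n))).toReal := fun n => by
    rw [hν', ENNReal.toReal_ofReal (hnonneg _)]
    simpa [(hW n).1] using hmass (W n)
  have hgap : 0 < 1 - 2 / q := sub_pos.2 ((div_lt_one (two_pos.trans hinf)).2 hinf)
  have hlogL : ∀ n : ℕ, n * Real.log 2 ≤ -Real.log (L n) := fun n => by
    have h := le_div_two_pow hhalf 0 n
    simp only [zero_add, hL, Finset.range_zero, Finset.prod_empty] at h
    have h' := Real.log_le_log (hLpos n) h
    rw [one_div, Real.log_inv, Real.log_pow] at h'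
    linarith
  have hδlog : 0 ≤ -Real.log δ := neg_nonneg.2 (Real.log_nonpos hδ0.le hδ1)
  have hlog2 : 0 < Real.log 2 := Real.log_pos one_lt_two
  simp_rw [lowerLocalDim, upperLocalDim, hLW]
  refine exponents_eq_of_scales (M := M) (c := (1 - 2 / q) / 2) (K := -Real.log δ / Real.log 2)
    (m := fun r => (ν' (closedBall x r)).toReal)
    (μ := fun n => (ν' (moranI A (W n))).toReal) hLpos hhalf (by simp [hL]) hLM
    (by linarith [hA 0, hAM 0]) (half_pos hgap) ?_ ?_ ?_ ?_ ?_ ?_ (div_nonneg hδlog hlog2.le) ?_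
  · have : 0 < 2 / q := div_pos two_pos (two_pos.trans hinf)
    linarith
  · exact fun r s hrs =>
      ENNReal.toReal_mono (measure_ne_top _ _) (measure_mono (closedBall_subset_closedBall hrs))
  · exact fun r => measureReal_le_one
  · exact fun n => (pow_pos hδ0 n).trans_le (hmassW n)
  · intro n
    rw [← hLW]
    exact ENNReal.toReal_mono (measure_ne_top _ _)
      (measure_mono (moranI_subset_closedBall (hW n).2))
  · intro n
    rw [← hLW]
    exact ENNReal.toReal_mono (measure_ne_top _ _)
      (measure_closedBall_le hA hinf hqA (half_pos hgap).le (half_lt_self hgap) hnonneg hν'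
        (hW n).2)
  · intro n
    have h := Real.log_le_log (pow_pos hδ0 n) (hmassW n)
    rw [Real.log_pow] at h
    calc -Real.log (ν' (moranI A (W n))).toReal ≤ n * -Real.log δ := by linarith
      _ = -Real.log δ / Real.log 2 * (n * Real.log 2) := by field_simp
      _ ≤ -Real.log δ / Real.log 2 * -Real.log (L n) :=
        mul_le_mul_of_nonneg_left (hlogL n) (div_nonneg hδlog hlog2.le)
end

section
/- For every s ∈ ℝ, the lower L^q-spectrum of μ equals τ̲_μ(s) = min{β1(s), β2(s)} and the upper L^q-spectrum equals τ̄_μ(s) = max{β1(s), β2(s)}; in particular, for s ∉ {0,1} with β1(s) ≠ β2(s) the L^q-spectrum (free energy function) of μ does not exist at s. -/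
open MeasureTheory Filter Set Metric Topology

namespace Moran

section Words

variable {c r : ℕ → ℝ}

theorem moranCyl_append (w v : List Bool) (n : ℕ) (st : ℝ × ℝ) :
    moranCyl c (w ++ v) n st = moranCyl c v (n + w.length) (moranCyl c w n st) := by
  induction w generalizing n st with
  | nil => rfl
  | cons b w ih =>
    simp only [List.cons_append, moranCyl, ih, List.length_cons]
    rw [show n + 1 + w.length = n + (w.length + 1) by omega]

theorem moranCyl_snd (w : List Bool) (n : ℕ) (st : ℝ × ℝ) :
    (moranCyl c w n st).2 = st.2 / ∏ i ∈ Finset.range w.length, c (n + i) := by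
  induction w generalizing n st with
  | nil => simp [moranCyl]
  | cons b w ih =>
    have h : (if b then (st.1 + st.2 - st.2 / c n, st.2 / c n)
        else (st.1, st.2 / c n) : ℝ × ℝ).2 = st.2 / c n := by cases b <;> rfl
    rw [moranCyl, ih, h, List.length_cons, Finset.prod_range_succ', div_div, mul_comm, add_zero]
    congr 2
    exact Finset.prod_congr rfl fun i _ => by rw [add_assoc, add_comm 1 i]

theorem moranCyl_nested (w : List Bool) (n : ℕ) (hc : ∀ k, n ≤ k → 1 ≤ c k) (st : ℝ × ℝ)
    (hst : 0 ≤ st.2) :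
    st.1 ≤ (moranCyl c w n st).1 ∧
      (moranCyl c w n st).1 + (moranCyl c w n st).2 ≤ st.1 + st.2 ∧
      0 ≤ (moranCyl c w n st).2 ∧ (moranCyl c w n st).2 ≤ st.2 := by
  induction w generalizing n st with
  | nil => simp [moranCyl, hst]
  | cons b w ih =>
    have hn := hc n le_rfl
    have h1 : st.2 / c n ≤ st.2 := div_le_self hst hn
    have h0 : 0 ≤ st.2 / c n := div_nonneg hst (by linarith)
    cases b
    · have := ih (n + 1) (fun k hk => hc k (by omega)) (st.1, st.2 / c n) h0
      simp only [moranCyl, Bool.false_eq_true, if_false] at this ⊢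
      refine ⟨this.1, ?_, this.2.2.1, ?_⟩ <;> linarith [this.2.1, this.2.2.2]
    · have := ih (n + 1) (fun k hk => hc k (by omega))
        (st.1 + st.2 - st.2 / c n, st.2 / c n) h0
      simp only [moranCyl, if_true] at this ⊢
      refine ⟨?_, ?_, this.2.2.1, ?_⟩ <;> linarith [this.1, this.2.1, this.2.2.2]

theorem moranCyl_replicate_false_fst (j n : ℕ) (st : ℝ × ℝ) :
    (moranCyl c (List.replicate j false) n st).1 = st.1 := by
  induction j generalizing n st with
  | zero => rfl
  | succ j ih => simp [List.replicate_succ, moranCyl, ih]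

theorem moranCyl_separated {B : ℝ} (hB : 2 < B) (w w' : List Bool) (n : ℕ)
    (hc : ∀ k, n ≤ k → B ≤ c k) (st : ℝ × ℝ) (hst : 0 ≤ st.2)
    (hlen : w.length = w'.length) (hne : w ≠ w') {x y : ℝ}
    (hx : x ∈ Icc (moranCyl c w n st).1 ((moranCyl c w n st).1 + (moranCyl c w n st).2))
    (hy : y ∈ Icc (moranCyl c w' n st).1 ((moranCyl c w' n st).1 + (moranCyl c w' n st).2)) :
    (B - 2) * (moranCyl c w n st).2 ≤ |x - y| := by
  induction w generalizing n st w' with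
  | nil =>
    cases w' with
    | nil => exact absurd rfl hne
    | cons _ _ => simp at hlen
  | cons b w ih =>
    cases w' with
    | nil => simp at hlen
    | cons b' w' =>
      have hc' : ∀ k, n + 1 ≤ k → 1 ≤ c k := fun k hk => by linarith [hc k (by omega)]
      have hn := hc n le_rfl
      have h0 : 0 ≤ st.2 / c n := div_nonneg hst (by linarith)
      have hgap : (B - 2) * (st.2 / c n) ≤ st.2 - 2 * (st.2 / c n) := by
        have : st.2 / c n * c n = st.2 := div_mul_cancel₀ _ (by linarith)
        nlinarith
      simp only [List.length_cons, add_left_inj] at hlen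
      by_cases hb : b = b'
      · subst hb
        have hne' : w ≠ w' := fun h => hne (by rw [h])
        refine ih w' (n + 1) (fun k hk => hc k (by omega)) _ ?_ hlen hne' hx hy
        cases b <;> exact h0
      · have hL := moranCyl_nested w (n + 1) hc' (st.1, st.2 / c n) h0
        have hR := moranCyl_nested w (n + 1) hc' (st.1 + st.2 - st.2 / c n, st.2 / c n) h0
        have hL' := moranCyl_nested w' (n + 1) hc' (st.1, st.2 / c n) h0
        have hR' := moranCyl_nested w' (n + 1) hc' (st.1 + st.2 - st.2 / c n, st.2 / c n) h0
        cases b <;> cases b' <;>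
          simp only [moranCyl, Bool.false_eq_true, if_false, if_true, not_true_eq_false,
            mem_Icc] at *
        · rw [abs_sub_comm]
          refine le_trans ?_ (le_abs_self _)
          nlinarith [hL.2.2.2, hL.2.1, hR'.1, hx.2, hy.1]
        · refine le_trans ?_ (le_abs_self _)
          nlinarith [hR.2.2.2, hR.1, hL'.2.1, hx.1, hy.2]

theorem cylMass_append (w v : List Bool) (n : ℕ) (m : ℝ) :
    cylMass r (w ++ v) n m = cylMass r v (n + w.length) (cylMass r w n m) := by
  induction w generalizing n m with
  | nil => rfl
  | cons b w ih =>
    simp only [List.cons_append, cylMass, ih, List.length_cons]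
    rw [show n + 1 + w.length = n + (w.length + 1) by omega]

theorem cylMass_bounds {ρ : ℝ} (hρ : 0 < ρ) (w : List Bool) (n : ℕ)
    (hr : ∀ k, n ≤ k → ρ ≤ r k ∧ r k ≤ 1 - ρ) {m : ℝ} (hm : 0 < m) :
    0 < cylMass r w n m ∧ cylMass r w n m ≤ m ∧ m ≤ (ρ⁻¹) ^ w.length * cylMass r w n m := by
  induction w generalizing n m with
  | nil => simp [cylMass, hm]
  | cons b w ih =>
    obtain ⟨h1, h2⟩ := hr n le_rfl
    obtain ⟨t, ht, htρ, ht1⟩ : ∃ t, (if b then (1 - r n) * m else r n * m) = t * m ∧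
        ρ ≤ t ∧ t ≤ 1 := by
      cases b
      · exact ⟨r n, rfl, h1, by linarith⟩
      · exact ⟨1 - r n, rfl, by linarith, by linarith⟩
    obtain ⟨i0, i1, i2⟩ := ih (n + 1) (fun k hk => hr k (by omega)) (m := t * m) (by nlinarith)
    simp only [cylMass, ht, List.length_cons]
    refine ⟨i0, by nlinarith, ?_⟩
    rw [pow_succ', mul_assoc]
    calc m = ρ⁻¹ * (ρ * m) := by field_simp
      _ ≤ ρ⁻¹ * (t * m) := by gcongr
      _ ≤ _ := by gcongr

/-- The binary words of length `n`. -/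
def words : ℕ → Finset (List Bool)
  | 0 => {[]}
  | n + 1 => (words n).image (List.cons false) ∪ (words n).image (List.cons true)

theorem mem_words {n : ℕ} {w : List Bool} : w ∈ words n ↔ w.length = n := by
  induction n generalizing w with
  | zero => simp [words]
  | succ n ih =>
    cases w with
    | nil => simp [words]
    | cons b w => cases b <;> simp [words, ih]

theorem sum_words_succ (n : ℕ) (f : List Bool → ℝ) :
    ∑ w ∈ words (n + 1), f w = ∑ w ∈ words n, (f (false :: w) + f (true :: w)) := by
  rw [words, Finset.sum_union, Finset.sum_image (by simp), Finset.sum_image (by simp),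
    Finset.sum_add_distrib]
  simp [Finset.disjoint_left]

theorem sum_cylMass_rpow (s : ℝ) (l n : ℕ) (hr : ∀ k, n ≤ k → 0 < r k ∧ r k < 1) {m : ℝ}
    (hm : 0 < m) :
    ∑ w ∈ words l, cylMass r w n m ^ s =
      m ^ s * ∏ i ∈ Finset.range l, (r (n + i) ^ s + (1 - r (n + i)) ^ s) := by
  induction l generalizing n m with
  | zero => simp [words, cylMass]
  | succ l ih =>
    obtain ⟨h0, h1⟩ := hr n le_rfl
    have h1' : 0 < 1 - r n := by linarith
    have hr' : ∀ k, n + 1 ≤ k → 0 < r k ∧ r k < 1 := fun k hk => hr k (by omega)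
    rw [sum_words_succ, Finset.sum_add_distrib]
    simp only [cylMass, Bool.false_eq_true, if_false, if_true]
    rw [ih (n + 1) hr' (mul_pos h0 hm), ih (n + 1) hr' (mul_pos h1' hm),
      Real.mul_rpow h0.le hm.le, Real.mul_rpow h1'.le hm.le, Finset.prod_range_succ', add_zero]
    have : ∏ i ∈ Finset.range l, (r (n + 1 + i) ^ s + (1 - r (n + 1 + i)) ^ s) =
        ∏ i ∈ Finset.range l, (r (n + (i + 1)) ^ s + (1 - r (n + (i + 1))) ^ s) :=
      Finset.prod_congr rfl fun i _ => by rw [add_assoc, add_comm 1 i]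
    rw [this]
    ring

end Words

theorem rpow_comparable {a b T : ℝ} (ha : 0 < a) (hab : a ≤ b) (hb : b ≤ T * a) (s : ℝ) :
    b ^ s ≤ T ^ |s| * a ^ s ∧ a ^ s ≤ T ^ |s| * b ^ s := by
  have hb0 : 0 < b := ha.trans_le hab
  have hT : 1 ≤ T := by
    by_contra h
    nlinarith
  have hT0 : 0 < T := by linarith
  have h1 : 1 ≤ T ^ |s| := Real.one_le_rpow hT (abs_nonneg s)
  have pa := Real.rpow_pos_of_pos ha s
  have pb := Real.rpow_pos_of_pos hb0 s
  have pt := Real.rpow_pos_of_pos hT0 s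
  rcases le_total 0 s with hs | hs
  · rw [abs_of_nonneg hs] at h1 ⊢
    refine ⟨?_, ?_⟩
    · rw [← Real.mul_rpow hT0.le ha.le]
      exact Real.rpow_le_rpow hb0.le hb hs
    · have := Real.rpow_le_rpow ha.le hab hs
      nlinarith
  · rw [abs_of_nonpos hs] at h1 ⊢
    refine ⟨?_, ?_⟩
    · have := Real.rpow_le_rpow_of_nonpos ha hab hs
      nlinarith
    · have := Real.rpow_le_rpow_of_nonpos hb0 hb hs
      rw [Real.mul_rpow hT0.le ha.le] at this
      rw [Real.rpow_neg hT0.le, inv_mul_eq_div, le_div_iff₀ pt]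
      linarith

/-- Moran data with ratios in `[B, A]`, `B > 2`, and weights in `[ρ, 1 - ρ]`. -/
structure Regular (c r : ℕ → ℝ) (A B ρ : ℝ) : Prop where
  two_lt : 2 < B
  le_c : ∀ k, 1 ≤ k → B ≤ c k
  c_le : ∀ k, 1 ≤ k → c k ≤ A
  pos : 0 < ρ
  le_r : ∀ k, 1 ≤ k → ρ ≤ r k
  r_le : ∀ k, 1 ≤ k → r k ≤ 1 - ρ

/-- The common length of the basic intervals of level `n`. -/
noncomputable def levelLen (c : ℕ → ℝ) (n : ℕ) : ℝ :=
  1 / ∏ i ∈ Finset.range n, c (1 + i)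

/-- The sum of `μ(I_w) ^ s` over the words `w` of length `n`. -/
noncomputable def levelSum (r : ℕ → ℝ) (s : ℝ) (n : ℕ) : ℝ :=
  ∏ i ∈ Finset.range n, (r (1 + i) ^ s + (1 - r (1 + i)) ^ s)

/-- The left endpoint of the basic interval `I_w`. -/
noncomputable def leftEnd (c : ℕ → ℝ) (w : List Bool) : ℝ := (moranCyl c w 1 (0, 1)).1

theorem moranCyl_snd_eq_levelLen (c : ℕ → ℝ) (w : List Bool) :
    (moranCyl c w 1 (0, 1)).2 = levelLen c w.length := moranCyl_snd w 1 (0, 1)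

namespace Regular

variable {c r : ℕ → ℝ} {A B ρ : ℝ}

theorem one_le_c (h : Regular c r A B ρ) (k : ℕ) (hk : 1 ≤ k) : 1 ≤ c k := by
  linarith [h.le_c k hk, h.two_lt]

theorem r_bounds (h : Regular c r A B ρ) (k : ℕ) (hk : 1 ≤ k) : ρ ≤ r k ∧ r k ≤ 1 - ρ :=
  ⟨h.le_r k hk, h.r_le k hk⟩

theorem r_mem (h : Regular c r A B ρ) (k : ℕ) (hk : 1 ≤ k) : 0 < r k ∧ r k < 1 := by
  have := h.pos
  constructor <;> linarith [h.le_r k hk, h.r_le k hk]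

theorem levelLen_pos (h : Regular c r A B ρ) (n : ℕ) : 0 < levelLen c n :=
  one_div_pos.2 (Finset.prod_pos fun i _ => by linarith [h.one_le_c (1 + i) (by omega)])

theorem two_mul_levelLen_succ_le (h : Regular c r A B ρ) (n : ℕ) :
    2 * levelLen c (n + 1) ≤ levelLen c n := by
  have hc : 2 ≤ c (1 + n) := by linarith [h.le_c (1 + n) (by omega), h.two_lt]
  have hp := h.levelLen_pos n
  have : levelLen c (n + 1) = levelLen c n / c (1 + n) := by
    rw [levelLen, levelLen, Finset.prod_range_succ, div_div]
  rw [this, mul_div_assoc', div_le_iff₀ (by linarith)]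
  nlinarith

theorem two_pow_mul_levelLen_add_le (h : Regular c r A B ρ) (m k : ℕ) :
    2 ^ k * levelLen c (m + k) ≤ levelLen c m := by
  induction k with
  | zero => simp
  | succ k ih =>
    have := h.two_mul_levelLen_succ_le (m + k)
    calc (2 : ℝ) ^ (k + 1) * levelLen c (m + (k + 1))
        = 2 ^ k * (2 * levelLen c (m + k + 1)) := by rw [pow_succ, ← add_assoc]; ring
      _ ≤ 2 ^ k * levelLen c (m + k) := by gcongr
      _ ≤ _ := ih

theorem levelSum_pos (h : Regular c r A B ρ) (s : ℝ) (n : ℕ) : 0 < levelSum r s n := by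
  refine Finset.prod_pos fun i _ => ?_
  obtain ⟨h0, h1⟩ := h.r_mem (1 + i) (by omega)
  have := Real.rpow_pos_of_pos h0 s
  have := Real.rpow_pos_of_pos (sub_pos.2 h1) s
  linarith

theorem levelSum_add_le (h : Regular c r A B ρ) (s : ℝ) (m k : ℕ) :
    levelSum r s (m + k) ≤ (2 * (ρ⁻¹) ^ |s|) ^ k * levelSum r s m := by
  have hb : ∀ a, ρ ≤ a → a ≤ 1 → a ^ s ≤ (ρ⁻¹) ^ |s| := fun a h1 h2 => by
    have h3 : 1 ≤ ρ⁻¹ * a := by rwa [inv_mul_eq_div, one_le_div h.pos]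
    simpa using (rpow_comparable (h.pos.trans_le h1) h2 h3 s).2
  induction k with
  | zero => simp
  | succ k ih =>
    have hr1 := h.le_r (1 + (m + k)) (by omega)
    have hr2 := h.r_le (1 + (m + k)) (by omega)
    have hρ := h.pos
    have h1 := hb _ hr1 (by linarith)
    have h2 := hb (1 - r (1 + (m + k))) (by linarith) (by linarith)
    have hp := h.levelSum_pos s (m + k)
    have hs : levelSum r s (m + (k + 1)) = levelSum r s (m + k) *
        (r (1 + (m + k)) ^ s + (1 - r (1 + (m + k))) ^ s) := by
      rw [levelSum, levelSum, ← add_assoc, Finset.prod_range_succ]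
    have hT : 0 ≤ 2 * (ρ⁻¹) ^ |s| := by positivity
    rw [hs]
    calc _ ≤ levelSum r s (m + k) * (2 * (ρ⁻¹) ^ |s|) := by gcongr; linarith
      _ ≤ (2 * (ρ⁻¹) ^ |s|) ^ k * levelSum r s m * (2 * (ρ⁻¹) ^ |s|) := by gcongr
      _ = _ := by ring

theorem sum_cylMass_rpow_eq (h : Regular c r A B ρ) (s : ℝ) (n : ℕ) :
    ∑ w ∈ words n, cylMass r w 1 1 ^ s = levelSum r s n := by
  rw [sum_cylMass_rpow s n 1 h.r_mem one_pos, Real.one_rpow, one_mul, levelSum]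

theorem sum_cylMass_eq_one (h : Regular c r A B ρ) (n : ℕ) :
    ∑ w ∈ words n, cylMass r w 1 1 = 1 := by
  simpa [levelSum] using h.sum_cylMass_rpow_eq 1 n

theorem moranI_append_subset (h : Regular c r A B ρ) (w v : List Bool) :
    moranI c (w ++ v) ⊆ moranI c w := by
  have h1 := moranCyl_nested w 1 h.one_le_c (0, 1) zero_le_one
  have h2 := moranCyl_nested v (1 + w.length) (fun k hk => h.one_le_c k (by omega)) _ h1.2.2.1
  rw [moranI, moranI, moranCyl_append]
  exact Icc_subset_Icc h2.1 h2.2.1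

theorem leftEnd_mem_moranI_append (h : Regular c r A B ρ) (w : List Bool) (j : ℕ) :
    leftEnd c w ∈ moranI c (w ++ List.replicate j false) := by
  have h1 := moranCyl_nested (w ++ List.replicate j false) 1 h.one_le_c (0, 1) zero_le_one
  have h2 : (moranCyl c (w ++ List.replicate j false) 1 (0, 1)).1 = leftEnd c w := by
    rw [moranCyl_append, moranCyl_replicate_false_fst, leftEnd]
  rw [moranI, h2]
  exact ⟨le_rfl, by linarith [h1.2.2.1]⟩

theorem leftEnd_mem_moranI (h : Regular c r A B ρ) (w : List Bool) :
    leftEnd c w ∈ moranI c w := by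
  simpa using h.leftEnd_mem_moranI_append w 0

theorem leftEnd_mem_moranSet (h : Regular c r A B ρ) (w : List Bool) :
    leftEnd c w ∈ moranSet c := by
  simp only [moranSet, mem_iInter, mem_iUnion, mem_ofPred_eq]
  intro n
  let w' := w ++ List.replicate n false
  refine ⟨w'.take n, by simp [w'], ?_⟩
  refine h.moranI_append_subset (w'.take n) (w'.drop n) ?_
  rw [List.take_append_drop]
  exact h.leftEnd_mem_moranI_append w n

theorem separated (h : Regular c r A B ρ) {w w' : List Bool} (hlen : w.length = w'.length)
    (hne : w ≠ w') {x y : ℝ} (hx : x ∈ moranI c w) (hy : y ∈ moranI c w') :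
    (B - 2) * levelLen c w.length ≤ |x - y| := by
  rw [← moranCyl_snd_eq_levelLen]
  exact moranCyl_separated h.two_lt w w' 1 h.le_c (0, 1) zero_le_one hlen hne hx hy

theorem moranI_subset_closedBall {w : List Bool} {x rr : ℝ}
    (hx : x ∈ moranI c w) (hrr : levelLen c w.length ≤ rr) :
    moranI c w ⊆ closedBall x rr := by
  intro y hy
  rw [← moranCyl_snd_eq_levelLen] at hrr
  rw [moranI, mem_Icc] at hx hy
  rw [mem_closedBall, Real.dist_eq, abs_le]
  constructor <;> linarith [hx.1, hx.2, hy.1, hy.2]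

variable {μ : Measure ℝ} [IsProbabilityMeasure μ]

theorem cylMass_pos (h : Regular c r A B ρ) (w : List Bool) : 0 < cylMass r w 1 1 :=
  (cylMass_bounds h.pos w 1 h.r_bounds one_pos).1

theorem cylMass_append_bounds (h : Regular c r A B ρ) (w v : List Bool) :
    cylMass r (w ++ v) 1 1 ≤ cylMass r w 1 1 ∧
      cylMass r w 1 1 ≤ (ρ⁻¹) ^ v.length * cylMass r (w ++ v) 1 1 := by
  rw [cylMass_append]
  exact (cylMass_bounds h.pos v (1 + w.length) (fun k hk => h.r_bounds k (by omega))
    (h.cylMass_pos w)).2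

theorem cylMass_le_measure_closedBall
    (hμ : ∀ w, μ (moranI c w) = ENNReal.ofReal (cylMass r w 1 1))
    {w : List Bool} {x rr : ℝ} (hx : x ∈ moranI c w) (hrr : levelLen c w.length ≤ rr) :
    cylMass r w 1 1 ≤ (μ (closedBall x rr)).toReal := by
  rw [← ENNReal.ofReal_le_iff_le_toReal (measure_ne_top _ _), ← hμ]
  exact measure_mono (moranI_subset_closedBall hx hrr)

theorem measure_closedBall_le_cylMass
    (h : Regular c r A B ρ) (hμ : ∀ w, μ (moranI c w) = ENNReal.ofReal (cylMass r w 1 1))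
    {w : List Bool} {x rr : ℝ} (hx : x ∈ moranI c w)
    (hrr : rr < (B - 2) * levelLen c w.length) :
    (μ (closedBall x rr)).toReal ≤ cylMass r w 1 1 := by
  set W := (words w.length).erase w
  have hmem : ∀ v ∈ W, v.length = w.length ∧ v ≠ w := fun v hv =>
    ⟨mem_words.1 (Finset.mem_of_mem_erase hv), Finset.ne_of_mem_erase hv⟩
  have hgap : 0 < (B - 2) * levelLen c w.length :=
    mul_pos (sub_pos.2 h.two_lt) (h.levelLen_pos _)
  have hdisj : (W : Set (List Bool)).PairwiseDisjoint (moranI c) := by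
    intro v hv v' hv' hne
    rw [Function.onFun, Set.disjoint_left]
    intro y hy hy'
    have h1 := hmem v hv
    have := h.separated (h1.1.trans (hmem v' hv').1.symm) hne hy hy'
    rw [h1.1] at this
    simp only [sub_self, abs_zero] at this
    linarith
  have hmeas : ∀ v ∈ W, MeasurableSet (moranI c v) := fun v _ => measurableSet_Icc
  have hU : μ.real (⋃ v ∈ W, moranI c v) = 1 - cylMass r w 1 1 := by
    rw [measureReal_biUnion_finset hdisj hmeas]
    have h1 := Finset.sum_erase_add (words w.length) (fun v => cylMass r v 1 1)
      (mem_words.2 rfl : w ∈ words w.length)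
    rw [h.sum_cylMass_eq_one] at h1
    rw [← eq_sub_of_add_eq h1]
    refine Finset.sum_congr rfl fun v _ => ?_
    rw [measureReal_def, hμ, ENNReal.toReal_ofReal (h.cylMass_pos v).le]
  have hsub : closedBall x rr ⊆ (⋃ v ∈ W, moranI c v)ᶜ := by
    intro y hy hyU
    simp only [mem_iUnion] at hyU
    obtain ⟨v, hv, hyv⟩ := hyU
    have := h.separated (hmem v hv).1.symm (hmem v hv).2.symm hx hyv
    rw [mem_closedBall, Real.dist_eq, abs_sub_comm] at hy
    linarith
  calc (μ (closedBall x rr)).toReal ≤ μ.real (⋃ v ∈ W, moranI c v)ᶜ :=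
        measureReal_mono hsub
    _ = cylMass r w 1 1 := by
      rw [probReal_compl_eq_one_sub (Finset.measurableSet_biUnion _ hmeas), hU]
      ring

/-- The packing sums at a scale `rr` between two consecutive level lengths are comparable to
the sum over the basic intervals of that level, with constants independent of `rr`. -/
theorem packSup_bounds
    (h : Regular c r A B ρ) (hμ : ∀ w, μ (moranI c w) = ENNReal.ofReal (cylMass r w 1 1))
    {k : ℕ} (hk : 2 < 2 ^ k * (B - 2)) (s : ℝ) (m : ℕ) {rr : ℝ}
    (h1 : levelLen c (m + (k + 1)) ≤ rr) (h2 : rr < levelLen c (m + k)) :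
    packSup μ (moranSet c) rr s ≤
        ((ρ⁻¹) ^ (k + 1)) ^ |s| * levelSum r s (m + (k + 1)) ∧
      levelSum r s (m + (k + 1)) ≤ (2 * (ρ⁻¹) ^ |s|) ^ (k + 1) * ((ρ⁻¹) ^ (k + 1)) ^ |s| *
        packSup μ (moranSet c) rr s := by
  have hρ := h.pos
  have hB := h.two_lt
  set D := ((ρ⁻¹) ^ (k + 1)) ^ |s|
  have hD0 : 0 ≤ D := by positivity
  have hrr0 : 0 < rr := (h.levelLen_pos _).trans_le h1
  have hsep : 2 * rr < (B - 2) * levelLen c m := by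
    have h3 := h.two_pow_mul_levelLen_add_le m k
    have h4 := h.levelLen_pos (m + k)
    nlinarith
  have hball : ∀ w v : List Bool, w.length = m → v.length = k + 1 →
      ∀ x ∈ moranI c (w ++ v), cylMass r (w ++ v) 1 1 ≤ (μ (closedBall x rr)).toReal ∧
        (μ (closedBall x rr)).toReal ≤ cylMass r w 1 1 := by
    intro w v hw hv x hx
    refine ⟨cylMass_le_measure_closedBall hμ hx ?_,
      h.measure_closedBall_le_cylMass hμ (h.moranI_append_subset w v hx) ?_⟩
    · rwa [List.length_append, hw, hv]
    · rw [hw]; linarith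
  have hupper : ∀ y ∈ {y : ℝ | ∃ t : Finset ℝ, (↑t : Set ℝ) ⊆ moranSet c ∧
      (↑t : Set ℝ).Pairwise (fun u v => Disjoint (closedBall u rr) (closedBall v rr)) ∧
      y = ∑ u ∈ t, (μ (closedBall u rr)).toReal ^ s},
      y ≤ D * levelSum r s (m + (k + 1)) := by
    rintro y ⟨t, htX, htd, rfl⟩
    have hex : ∀ u : ℝ, ∃ w : List Bool, u ∈ t →
        w.length = m + (k + 1) ∧ u ∈ moranI c w := by
      intro u
      by_cases hu : u ∈ t
      · have := htX hu
        simp only [moranSet, mem_iInter, mem_iUnion, mem_ofPred_eq] at this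
        obtain ⟨w, hw, hw'⟩ := this (m + (k + 1))
        exact ⟨w, fun _ => ⟨hw, hw'⟩⟩
      · exact ⟨[], fun hu' => absurd hu' hu⟩
    choose f hf using hex
    have hinj : Set.InjOn f t := by
      intro u hu v hv huv
      by_contra hne
      have hd := htd hu hv hne
      refine Set.disjoint_left.1 hd (mem_closedBall_self hrr0.le) ?_
      have hv' := hf v hv
      refine moranI_subset_closedBall hv'.2 (by rwa [hv'.1]) ?_
      rw [← huv]
      exact (hf u hu).2
    calc ∑ u ∈ t, (μ (closedBall u rr)).toReal ^ s
        ≤ ∑ u ∈ t, D * cylMass r (f u) 1 1 ^ s := by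
          refine Finset.sum_le_sum fun u hu => ?_
          obtain ⟨hl, hu'⟩ := hf u hu
          have hl' : ((f u).drop m).length = k + 1 := by simp [hl]
          have e := List.take_append_drop m (f u)
          have hb := hball ((f u).take m) ((f u).drop m) (by simp [hl]) hl' u (by rwa [e])
          have hc := (h.cylMass_append_bounds ((f u).take m) ((f u).drop m)).2
          rw [e] at hb hc
          rw [hl'] at hc
          exact (rpow_comparable (h.cylMass_pos _) hb.1 (hb.2.trans hc) s).1
      _ = D * ∑ w ∈ t.image f, cylMass r w 1 1 ^ s := by
          rw [Finset.sum_image hinj, Finset.mul_sum]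
      _ ≤ D * ∑ w ∈ words (m + (k + 1)), cylMass r w 1 1 ^ s := by
          gcongr
          · intro w _ _
            exact Real.rpow_nonneg (h.cylMass_pos w).le s
          · intro w hw
            obtain ⟨u, hu, rfl⟩ := Finset.mem_image.1 hw
            exact mem_words.2 (hf u hu).1
      _ = _ := by rw [h.sum_cylMass_rpow_eq]
  refine ⟨csSup_le ⟨0, ∅, by simp⟩ hupper, ?_⟩
  have hfar : ∀ w ∈ words m, ∀ w' ∈ words m, w ≠ w' →
      rr + rr < dist (leftEnd c w) (leftEnd c w') := by
    intro w hw w' hw' hne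
    rw [mem_words] at hw hw'
    have := h.separated (hw.trans hw'.symm) hne (h.leftEnd_mem_moranI w)
      (h.leftEnd_mem_moranI w')
    rw [hw] at this
    rw [Real.dist_eq]
    linarith
  have hinj : Set.InjOn (leftEnd c) (words m) := by
    intro w hw w' hw' he
    by_contra hne
    have := hfar w hw w' hw' hne
    rw [he, dist_self] at this
    linarith
  have hlow : ∑ w ∈ words m, (μ (closedBall (leftEnd c w) rr)).toReal ^ s ≤
      packSup μ (moranSet c) rr s := by
    refine le_csSup ⟨_, hupper⟩ ⟨(words m).image (leftEnd c), ?_, ?_, ?_⟩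
    · intro x hx
      obtain ⟨w, -, rfl⟩ := Finset.mem_image.1 (Finset.mem_coe.1 hx)
      exact h.leftEnd_mem_moranSet w
    · intro x hx y hy hne
      obtain ⟨w, hw, rfl⟩ := Finset.mem_image.1 (Finset.mem_coe.1 hx)
      obtain ⟨w', hw', rfl⟩ := Finset.mem_image.1 (Finset.mem_coe.1 hy)
      exact closedBall_disjoint_closedBall
        (hfar w hw w' hw' fun e => hne (congrArg _ e))
    · rw [Finset.sum_image hinj]
  have hm : levelSum r s m ≤ D * packSup μ (moranSet c) rr s := by
    rw [← h.sum_cylMass_rpow_eq]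
    refine le_trans ?_ (mul_le_mul_of_nonneg_left hlow hD0)
    rw [Finset.mul_sum]
    refine Finset.sum_le_sum fun w hw => ?_
    have hl : (List.replicate (k + 1) false).length = k + 1 := List.length_replicate
    have hb := hball w _ (mem_words.1 hw) hl _ (h.leftEnd_mem_moranI_append w (k + 1))
    have hc := (h.cylMass_append_bounds w (List.replicate (k + 1) false)).2
    rw [hl] at hc
    refine (rpow_comparable ((h.cylMass_pos _).trans_le hb.1) hb.2 (hc.trans ?_) s).1
    exact mul_le_mul_of_nonneg_left hb.1 (by positivity)
  calc levelSum r s (m + (k + 1))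
      ≤ (2 * (ρ⁻¹) ^ |s|) ^ (k + 1) * levelSum r s m := h.levelSum_add_le s m (k + 1)
    _ ≤ (2 * (ρ⁻¹) ^ |s|) ^ (k + 1) * (D * packSup μ (moranSet c) rr s) := by gcongr
    _ = _ := by ring

end Regular

section Asymptotics

/-- A function bounded asymptotically by `min a b` and `max a b` that approaches both `a` and `b`
along suitable sequences has these as its lower and upper limits. -/
theorem liminf_limsup_of_subseq {F : ℝ → ℝ} {l : Filter ℝ} [l.NeBot] {a b : ℝ}
    (hlo : ∀ ε > 0, ∀ᶠ x in l, min a b - ε ≤ F x) (hhi : ∀ ε > 0, ∀ᶠ x in l, F x ≤ max a b + ε)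
    {u v : ℕ → ℝ} (hu : Tendsto u atTop l) (hv : Tendsto v atTop l)
    (hFu : Tendsto (fun i => F (u i)) atTop (𝓝 a)) (hFv : Tendsto (fun i => F (v i)) atTop (𝓝 b)) :
    liminf F l = min a b ∧ limsup F l = max a b := by
  have bge : l.IsBoundedUnder (· ≥ ·) F := isBoundedUnder_of_eventually_ge (hlo 1 one_pos)
  have ble : l.IsBoundedUnder (· ≤ ·) F := isBoundedUnder_of_eventually_le (hhi 1 one_pos)
  have key : ∀ (w : ℕ → ℝ) (d : ℝ), Tendsto w atTop l → Tendsto (fun i => F (w i)) atTop (𝓝 d) →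
      liminf F l ≤ d ∧ d ≤ limsup F l := by
    intro w d hw hd
    have hd' : Tendsto F (map w atTop) (𝓝 d) := tendsto_map'_iff.2 hd
    rw [← hd'.liminf_eq]
    constructor
    · exact liminf_le_liminf_of_le hw bge hd'.isBoundedUnder_le.isCoboundedUnder_ge
    · rw [hd'.liminf_eq, ← hd'.limsup_eq]
      exact limsup_le_limsup_of_le hw hd'.isBoundedUnder_ge.isCoboundedUnder_le ble
  obtain ⟨u1, u2⟩ := key u a hu hFu
  obtain ⟨v1, v2⟩ := key v b hv hFv
  refine ⟨le_antisymm (le_min u1 v1) ?_, le_antisymm ?_ (max_le u2 v2)⟩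
  · refine le_of_forall_pos_le_add fun ε hε => sub_le_iff_le_add.1 ?_
    exact le_liminf_of_le ble.isCoboundedUnder_ge (hlo ε hε)
  · exact le_of_forall_pos_le_add fun ε hε =>
      limsup_le_of_le bge.isCoboundedUnder_le (hhi ε hε)

theorem abs_log_sub_log_le {x y C D : ℝ} (hx : 0 < x) (hy : 0 < y) (hC : 0 < C) (hD : 0 < D)
    (h1 : x ≤ C * y) (h2 : y ≤ D * x) :
    |Real.log x - Real.log y| ≤ |Real.log C| + |Real.log D| := by
  have e1 := Real.log_le_log hx h1
  have e2 := Real.log_le_log hy h2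
  rw [Real.log_mul hC.ne' hy.ne'] at e1
  rw [Real.log_mul hD.ne' hx.ne'] at e2
  rw [abs_le]
  constructor <;> linarith [le_abs_self (Real.log C), le_abs_self (Real.log D),
    abs_nonneg (Real.log C), abs_nonneg (Real.log D)]

namespace Regular

variable {c r : ℕ → ℝ} {A B ρ : ℝ}

theorem neg_log_levelLen (h : Regular c r A B ρ) (n : ℕ) :
    -Real.log (levelLen c n) = ∑ i ∈ Finset.range n, Real.log (c (1 + i)) := by
  rw [levelLen, one_div, Real.log_inv, neg_neg, Real.log_prod]
  intro i _
  linarith [h.one_le_c (1 + i) (by omega)]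

theorem log_levelSum (h : Regular c r A B ρ) (s : ℝ) (n : ℕ) :
    Real.log (levelSum r s n) =
      ∑ i ∈ Finset.range n, Real.log (r (1 + i) ^ s + (1 - r (1 + i)) ^ s) := by
  rw [levelSum, Real.log_prod]
  intro i _
  obtain ⟨h0, h1⟩ := h.r_mem (1 + i) (by omega)
  have := Real.rpow_pos_of_pos h0 s
  have := Real.rpow_pos_of_pos (sub_pos.2 h1) s
  linarith

theorem mul_log_two_le (h : Regular c r A B ρ) (n : ℕ) :
    n * Real.log 2 ≤ -Real.log (levelLen c n) := by
  rw [h.neg_log_levelLen, ← nsmul_eq_mul]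
  have := Finset.card_nsmul_le_sum (Finset.range n) (fun i => Real.log (c (1 + i)))
    (Real.log 2) fun i _ => ?_
  · rwa [Finset.card_range] at this
  exact Real.log_le_log two_pos (by linarith [h.le_c (1 + i) (by omega), h.two_lt])

theorem levelLen_le_c_mul (h : Regular c r A B ρ) (n : ℕ) :
    levelLen c n ≤ A * levelLen c (n + 1) := by
  have hc := h.one_le_c (1 + n) (by omega)
  have e : levelLen c (n + 1) = levelLen c n / c (1 + n) := by
    rw [levelLen, levelLen, Finset.prod_range_succ, div_div]
  rw [e, mul_div_assoc', le_div_iff₀ (by linarith), mul_comm]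
  exact mul_le_mul_of_nonneg_right (h.c_le _ (by omega)) (h.levelLen_pos n).le

theorem levelLen_zero (c : ℕ → ℝ) : levelLen c 0 = 1 := by simp [levelLen]

theorem tendsto_levelLen (h : Regular c r A B ρ) : Tendsto (levelLen c) atTop (𝓝[>] 0) := by
  refine tendsto_nhdsWithin_iff.2 ⟨?_, Eventually.of_forall h.levelLen_pos⟩
  refine squeeze_zero (fun n => (h.levelLen_pos n).le) (fun n => ?_)
    (tendsto_pow_atTop_nhds_zero_of_lt_one (r := (1 / 2 : ℝ)) (by norm_num) (by norm_num))
  have := h.two_pow_mul_levelLen_add_le 0 n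
  rw [zero_add, levelLen_zero] at this
  rw [one_div, inv_pow, ← one_div, le_div_iff₀ (by positivity)]
  linarith

theorem strictAnti_levelLen (h : Regular c r A B ρ) : StrictAnti (levelLen c) :=
  strictAnti_nat_of_succ_lt fun n => by
    linarith [h.two_mul_levelLen_succ_le n, h.levelLen_pos (n + 1)]

theorem exists_level (h : Regular c r A B ρ) (k : ℕ) {rr : ℝ} (h0 : 0 < rr)
    (hrr : rr < levelLen c k) :
    ∃ m, levelLen c (m + (k + 1)) ≤ rr ∧ rr < levelLen c (m + k) := by
  have hex : ∃ n, levelLen c n ≤ rr :=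
    ((tendsto_nhdsWithin_iff.1 h.tendsto_levelLen).1.eventually (ge_mem_nhds h0)).exists
  classical
  have hf := Nat.find_spec hex
  have hkn : k < Nat.find hex := by
    by_contra hle
    have := h.strictAnti_levelLen.antitone (not_lt.1 hle)
    linarith
  refine ⟨Nat.find hex - (k + 1), ?_, ?_⟩
  · rwa [Nat.sub_add_cancel hkn]
  · exact not_le.1 (Nat.find_min hex (by omega))

variable {μ : Measure ℝ} [IsProbabilityMeasure μ]

theorem exists_log_bounds
    (h : Regular c r A B ρ) (hμ : ∀ w, μ (moranI c w) = ENNReal.ofReal (cylMass r w 1 1)) (s : ℝ) :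
    ∃ (k : ℕ) (C : ℝ), 0 ≤ C ∧ ∀ (m : ℕ) (rr : ℝ), levelLen c (m + (k + 1)) ≤ rr →
      rr < levelLen c (m + k) →
      |Real.log (packSup μ (moranSet c) rr s) - Real.log (levelSum r s (m + (k + 1)))| ≤ C ∧
      |Real.log rr - Real.log (levelLen c (m + (k + 1)))| ≤ C := by
  have hB := h.two_lt
  have hρ := h.pos
  obtain ⟨k, hk⟩ := pow_unbounded_of_one_lt (2 / (B - 2)) one_lt_two
  rw [div_lt_iff₀ (by linarith)] at hk
  set C1 := ((ρ⁻¹) ^ (k + 1)) ^ |s|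
  set C2 := (2 * (ρ⁻¹) ^ |s|) ^ (k + 1) * ((ρ⁻¹) ^ (k + 1)) ^ |s|
  have hC10 : 0 < C1 := by positivity
  have hC20 : 0 < C2 := by positivity
  have hA : 0 < A := by linarith [h.one_le_c 1 le_rfl, h.c_le 1 le_rfl]
  refine ⟨k, max (|Real.log C1| + |Real.log C2|) (|Real.log A| + |Real.log 1|),
    le_max_of_le_left (by positivity), fun m rr h1 h2 => ⟨?_, ?_⟩⟩
  · obtain ⟨b1, b2⟩ := h.packSup_bounds hμ hk s m h1 h2
    have hS := h.levelSum_pos s (m + (k + 1))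
    have hP : 0 < packSup μ (moranSet c) rr s := by
      by_contra hP
      nlinarith
    exact (abs_log_sub_log_le hP hS hC10 hC20 b1 b2).trans (le_max_left _ _)
  · have hL := h.levelLen_pos (m + (k + 1))
    refine (abs_log_sub_log_le (hL.trans_le h1) hL hA one_pos ?_ (by linarith)).trans
      (le_max_right _ _)
    exact h2.le.trans (h.levelLen_le_c_mul (m + k))

/-- Bounds on the local exponents at every step bound the exponent of the packing sums. -/
theorem eventually_ratio_bounds
    (h : Regular c r A B ρ) (hμ : ∀ w, μ (moranI c w) = ENNReal.ofReal (cylMass r w 1 1)) (s : ℝ)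
    {lo hi : ℝ}
    (hlo : ∀ k, 1 ≤ k → lo * Real.log (c k) ≤ -Real.log (r k ^ s + (1 - r k) ^ s))
    (hhi : ∀ k, 1 ≤ k → -Real.log (r k ^ s + (1 - r k) ^ s) ≤ hi * Real.log (c k))
    {ε : ℝ} (hε : 0 < ε) :
    ∀ᶠ rr in 𝓝[>] (0 : ℝ),
      lo - ε ≤ Real.log (packSup μ (moranSet c) rr s) / Real.log rr ∧
      Real.log (packSup μ (moranSet c) rr s) / Real.log rr ≤ hi + ε := by
  obtain ⟨k, C, hC, hb⟩ := h.exists_log_bounds hμ s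
  set E := (1 + |lo| + |hi|) * C
  have hev : ∀ᶠ rr in 𝓝[>] (0 : ℝ), Real.log rr < min (-(E / ε)) 0 - 1 :=
    (Real.tendsto_log_nhdsGT_zero).eventually (eventually_lt_atBot _)
  have hsm : ∀ᶠ rr in 𝓝[>] (0 : ℝ), rr < levelLen c k :=
    mem_nhdsWithin_of_mem_nhds (Iio_mem_nhds (h.levelLen_pos k))
  filter_upwards [hev, hsm, self_mem_nhdsWithin] with rr h1 h2 h0
  obtain ⟨m, m1, m2⟩ := h.exists_level k h0 h2
  obtain ⟨b1, b2⟩ := hb m rr m1 m2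
  have hS1 : lo * -Real.log (levelLen c (m + (k + 1))) ≤
      -Real.log (levelSum r s (m + (k + 1))) := by
    rw [h.neg_log_levelLen, h.log_levelSum, Finset.mul_sum, ← Finset.sum_neg_distrib]
    exact Finset.sum_le_sum fun i _ => hlo (1 + i) (by omega)
  have hS2 : -Real.log (levelSum r s (m + (k + 1))) ≤
      hi * -Real.log (levelLen c (m + (k + 1))) := by
    rw [h.neg_log_levelLen, h.log_levelSum, Finset.mul_sum, ← Finset.sum_neg_distrib]
    exact Finset.sum_le_sum fun i _ => hhi (1 + i) (by omega)
  have hneg : Real.log rr < 0 := by linarith [min_le_right (-(E / ε)) 0]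
  have hlarge : E ≤ ε * -Real.log rr := by
    have : E / ε ≤ -Real.log rr := by linarith [min_le_left (-(E / ε)) 0]
    rwa [div_le_iff₀' hε] at this
  have m1' : |lo * (Real.log rr - Real.log (levelLen c (m + (k + 1))))| ≤ |lo| * C := by
    rw [abs_mul]; gcongr
  have m2' : |hi * (Real.log rr - Real.log (levelLen c (m + (k + 1))))| ≤ |hi| * C := by
    rw [abs_mul]; gcongr
  have hl := mul_nonneg (abs_nonneg lo) hC
  have hh := mul_nonneg (abs_nonneg hi) hC
  rw [abs_le] at b1 m1' m2'
  constructor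
  · rw [le_div_iff_of_neg hneg]
    linarith [m1'.1, m1'.2, b1.1, b1.2]
  · rw [div_le_iff_of_neg hneg]
    linarith [m2'.1, m2'.2, b1.1, b1.2]

/-- If the local exponent equals `a` at all steps in `(M i, K i]` and `M i / K i → 0`, then the
packing sums have exponent `a` along the level lengths `K i`. -/
theorem tendsto_ratio
    (h : Regular c r A B ρ) (hμ : ∀ w, μ (moranI c w) = ENNReal.ofReal (cylMass r w 1 1)) (s : ℝ)
    {a E : ℝ} {M K : ℕ → ℕ} (hK : Tendsto K atTop atTop)
    (hMK : Tendsto (fun i => (M i : ℝ) / K i) atTop (𝓝 0))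
    (hE : ∀ k, 1 ≤ k → |Real.log (r k ^ s + (1 - r k) ^ s) + a * Real.log (c k)| ≤ E)
    (hz : ∀ i k, M i < k → k ≤ K i →
      Real.log (r k ^ s + (1 - r k) ^ s) + a * Real.log (c k) = 0) :
    Tendsto (fun i => Real.log (packSup μ (moranSet c) (levelLen c (K i)) s) /
      Real.log (levelLen c (K i))) atTop (𝓝 a) := by
  obtain ⟨k, C, hC, hb⟩ := h.exists_log_bounds hμ s
  have hKr : Tendsto (fun i => (K i : ℝ)) atTop atTop := tendsto_natCast_atTop_atTop.comp hK
  have hE0 : 0 ≤ E := (abs_nonneg _).trans (hE 1 le_rfl)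
  have hl2 : 0 < Real.log 2 := Real.log_pos one_lt_two
  have hlim : Tendsto (fun i => (E * ((M i : ℝ) / K i) + C / K i) / Real.log 2) atTop (𝓝 0) := by
    simpa using ((hMK.const_mul E).add (hKr.const_div_atTop C)).div_const (Real.log 2)
  rw [tendsto_iff_norm_sub_tendsto_zero]
  refine squeeze_zero' (Eventually.of_forall fun i => norm_nonneg _) ?_ hlim
  filter_upwards [hK.eventually_ge_atTop (k + 1)] with i hi
  obtain ⟨m, hm⟩ := Nat.exists_eq_add_of_le' hi
  set n := K i
  have hnpos : (0 : ℝ) < n := by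
    have : 0 < n := by omega
    exact_mod_cast this
  have b1 := (hb m (levelLen c n) (by rw [hm])
    (h.strictAnti_levelLen (by omega))).1
  rw [← hm] at b1
  have hx := h.mul_log_two_le n
  have hx0 : 0 < -Real.log (levelLen c n) := lt_of_lt_of_le (by positivity) hx
  have hsum : |Real.log (levelSum r s n) + a * -Real.log (levelLen c n)| ≤ E * M i := by
    rw [h.neg_log_levelLen, h.log_levelSum, Finset.mul_sum, ← Finset.sum_add_distrib]
    refine (Finset.abs_sum_le_sum_abs _ _).trans ?_
    calc _ ≤ ∑ l ∈ Finset.range n, if l < M i then E else 0 := by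
          refine Finset.sum_le_sum fun l hl => ?_
          split_ifs with hlM
          · exact hE (1 + l) (by omega)
          · rw [hz i (1 + l) (by omega) (by have := Finset.mem_range.1 hl; omega), abs_zero]
      _ = (((Finset.range n).filter (· < M i)).card : ℝ) * E := by
          rw [← Finset.sum_filter, Finset.sum_const, nsmul_eq_mul]
      _ ≤ (M i : ℝ) * E := by
          gcongr
          refine (Finset.card_le_card (t := Finset.range (M i)) fun l hl => ?_).trans_eq
            (Finset.card_range _)
          exact Finset.mem_range.2 (Finset.mem_filter.1 hl).2
      _ = E * M i := mul_comm _ _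
  set P := Real.log (packSup μ (moranSet c) (levelLen c n) s)
  set L := Real.log (levelLen c n)
  have hL0 : L ≠ 0 := by linarith
  have e : P / L - a = (P + a * -L) / L := by field_simp; ring
  rw [e, Real.norm_eq_abs, abs_div, abs_of_neg (by linarith : L < 0), div_le_iff₀ hx0]
  have hnum : |P + a * -L| ≤ E * M i + C := by
    have := abs_add_le (P - Real.log (levelSum r s n)) (Real.log (levelSum r s n) + a * -L)
    rw [show P - Real.log (levelSum r s n) + (Real.log (levelSum r s n) + a * -L) =
      P + a * -L by ring] at this
    linarith
  refine hnum.trans ?_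
  calc E * M i + C = (E * ((M i : ℝ) / n) + C / n) / Real.log 2 * (n * Real.log 2) := by
        field_simp
    _ ≤ _ := by gcongr

end Regular

end Asymptotics

theorem exists_block {N : ℕ → ℕ} (hN0 : N 0 = 0) (hN : StrictMono N) {n : ℕ} (hn : 1 ≤ n) :
    ∃ j, N j < n ∧ n ≤ N (j + 1) := by
  have hex : ∃ j, n ≤ N j := ⟨n, hN.le_apply⟩
  classical
  have h1 := Nat.find_spec hex
  have h0 : Nat.find hex ≠ 0 := fun h => by rw [h, hN0] at h1; omega
  obtain ⟨j, hj⟩ := Nat.exists_eq_succ_of_ne_zero h0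
  refine ⟨j, not_le.1 (Nat.find_min hex (by omega)), ?_⟩
  rwa [hj] at h1

end Moran

/-- for every s, the lower L^q-spectrum of μ equals min{β₁(s), β₂(s)} and
the upper L^q-spectrum equals max{β₁(s), β₂(s)}; in particular, for s ∉ {0,1} with
β₁(s) ≠ β₂(s), the L^q-spectrum (free energy) of μ does not exist at s. -/
theorem stmt_19 (A B p q : ℝ) (N : ℕ → ℕ)
    (hBA : B < A) (hB2 : 2 < B)
    (hp0 : 0 < p) (hp2 : p ≤ 1 / 2) (hq0 : 0 < q) (hq2 : q ≤ 1 / 2)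
    (hN0 : N 0 = 0) (hNmono : StrictMono N)
    (hNlim : Tendsto (fun i : ℕ => (N (i + 1) : ℝ) / (N i : ℝ)) atTop atTop)
    (hpq : -Real.log p / Real.log A < -Real.log (1 - q) / Real.log B)
    (c r : ℕ → ℝ)
    (hcA : ∀ i n : ℕ, N (2 * i) < n → n ≤ N (2 * i + 1) → c n = A)
    (hcB : ∀ i n : ℕ, N (2 * i + 1) < n → n ≤ N (2 * i + 2) → c n = B)
    (hrp : ∀ i n : ℕ, N (2 * i) < n → n ≤ N (2 * i + 1) → r n = p)
    (hrq : ∀ i n : ℕ, N (2 * i + 1) < n → n ≤ N (2 * i + 2) → r n = q)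
    (μ : Measure ℝ) [IsProbabilityMeasure μ]
    (hμ : ∀ w : List Bool, μ (moranI c w) = ENNReal.ofReal (cylMass r w 1 1))
    :
    (∀ s : ℝ,
      liminf (fun rr : ℝ =>
          Real.log (packSup μ (moranSet c) rr s) / Real.log rr) (𝓝[>] 0) =
        min (betaFn p A s) (betaFn q B s) ∧
      limsup (fun rr : ℝ =>
          Real.log (packSup μ (moranSet c) rr s) / Real.log rr) (𝓝[>] 0) =
        max (betaFn p A s) (betaFn q B s)) ∧
    (∀ s : ℝ, s ≠ 0 → s ≠ 1 → betaFn p A s ≠ betaFn q B s →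
      ¬ ∃ L : ℝ, Tendsto (fun rr : ℝ =>
          Real.log (packSup μ (moranSet c) rr s) / Real.log rr) (𝓝[>] 0) (𝓝 L)) := by
  have hblock : ∀ k, 1 ≤ k → (c k = A ∧ r k = p) ∨ (c k = B ∧ r k = q) := by
    intro k hk
    obtain ⟨j, hj1, hj2⟩ := Moran.exists_block hN0 hNmono hk
    obtain ⟨i, rfl | rfl⟩ := Nat.even_or_odd' j
    · exact Or.inl ⟨hcA i k hj1 hj2, hrp i k hj1 hj2⟩
    · exact Or.inr ⟨hcB i k hj1 hj2, hrq i k hj1 hj2⟩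
  have h : Moran.Regular c r A B (min p q) := by
    have hmp := min_le_left p q
    have hmq := min_le_right p q
    refine ⟨hB2, fun k hk => ?_, fun k hk => ?_, lt_min hp0 hq0, fun k hk => ?_, fun k hk => ?_⟩ <;>
      rcases hblock k hk with ⟨h1, h2⟩ | ⟨h1, h2⟩ <;> simp only [h1, h2] <;> linarith
  have hlA : 0 < Real.log A := Real.log_pos (by linarith)
  have hlB : 0 < Real.log B := Real.log_pos (by linarith)
  have hβ : ∀ (s : ℝ) (k : ℕ), 1 ≤ k →
      -Real.log (r k ^ s + (1 - r k) ^ s) = betaFn p A s * Real.log (c k) ∧ c k = A ∨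
      -Real.log (r k ^ s + (1 - r k) ^ s) = betaFn q B s * Real.log (c k) ∧ c k = B := by
    intro s k hk
    rcases hblock k hk with ⟨h1, h2⟩ | ⟨h1, h2⟩
    · exact Or.inl ⟨by rw [h1, h2, betaFn, div_mul_cancel₀ _ hlA.ne'], h1⟩
    · exact Or.inr ⟨by rw [h1, h2, betaFn, div_mul_cancel₀ _ hlB.ne'], h1⟩
  have hlc : ∀ k, 1 ≤ k → 0 ≤ Real.log (c k) := fun k hk => Real.log_nonneg (h.one_le_c k hk)
  have he : Tendsto (fun i : ℕ => 2 * i) atTop atTop :=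
    tendsto_atTop_mono (fun i => by rw [id]; omega) tendsto_id
  have ho : Tendsto (fun i : ℕ => 2 * i + 1) atTop atTop :=
    tendsto_atTop_mono (fun i => by rw [id]; omega) tendsto_id
  have ht : Tendsto (fun i : ℕ => 2 * i + 2) atTop atTop :=
    tendsto_atTop_mono (fun i => by rw [id]; omega) tendsto_id
  have hAB : ∀ (s : ℝ), Tendsto (fun i => Real.log (packSup μ (moranSet c)
        (Moran.levelLen c (N (2 * i + 1))) s) / Real.log (Moran.levelLen c (N (2 * i + 1))))
        atTop (𝓝 (betaFn p A s)) ∧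
      Tendsto (fun i => Real.log (packSup μ (moranSet c)
        (Moran.levelLen c (N (2 * i + 2))) s) / Real.log (Moran.levelLen c (N (2 * i + 2))))
        atTop (𝓝 (betaFn q B s)) := by
    intro s
    have hE : ∀ a : ℝ, ∀ k, 1 ≤ k →
        |Real.log (r k ^ s + (1 - r k) ^ s) + a * Real.log (c k)| ≤
          max (|(a - betaFn p A s) * Real.log A|) (|(a - betaFn q B s) * Real.log B|) := by
      intro a k hk
      rcases hβ s k hk with ⟨h1, h2⟩ | ⟨h1, h2⟩
      · rw [h2] at h1 ⊢
        rw [neg_eq_iff_eq_neg.1 h1]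
        exact le_max_of_le_left (by ring_nf; rfl)
      · rw [h2] at h1 ⊢
        rw [neg_eq_iff_eq_neg.1 h1]
        exact le_max_of_le_right (by ring_nf; rfl)
    have hinv : Tendsto (fun j => (N j : ℝ) / N (j + 1)) atTop (𝓝 0) := by
      refine hNlim.inv_tendsto_atTop.congr fun j => ?_
      simp only [Pi.inv_apply, inv_div]
    constructor
    · refine h.tendsto_ratio hμ s (M := fun i => N (2 * i))
        (hNmono.tendsto_atTop.comp ho) (hinv.comp he) (hE _) fun i k h1 h2 => ?_
      rw [hcA i k h1 h2, hrp i k h1 h2, betaFn, div_mul_cancel₀ _ hlA.ne']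
      ring
    · refine h.tendsto_ratio hμ s (M := fun i => N (2 * i + 1))
        (hNmono.tendsto_atTop.comp ht) (hinv.comp ho) (hE _) fun i k h1 h2 => ?_
      rw [hcB i k h1 h2, hrq i k h1 h2, betaFn, div_mul_cancel₀ _ hlB.ne']
      ring
  have huo : Tendsto (fun i => Moran.levelLen c (N (2 * i + 1))) atTop (𝓝[>] 0) :=
    h.tendsto_levelLen.comp (hNmono.tendsto_atTop.comp ho)
  have hut : Tendsto (fun i => Moran.levelLen c (N (2 * i + 2))) atTop (𝓝[>] 0) :=
    h.tendsto_levelLen.comp (hNmono.tendsto_atTop.comp ht)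
  refine ⟨fun s => ?_, fun s _ _ hne => ?_⟩
  · have hev := fun ε (hε : (0 : ℝ) < ε) => h.eventually_ratio_bounds hμ s
      (lo := min (betaFn p A s) (betaFn q B s)) (hi := max (betaFn p A s) (betaFn q B s))
      (fun k hk => by
        rcases hβ s k hk with ⟨h1, -⟩ | ⟨h1, -⟩ <;> rw [h1]
        · exact mul_le_mul_of_nonneg_right (min_le_left _ _) (hlc k hk)
        · exact mul_le_mul_of_nonneg_right (min_le_right _ _) (hlc k hk))
      (fun k hk => by
        rcases hβ s k hk with ⟨h1, -⟩ | ⟨h1, -⟩ <;> rw [h1]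
        · exact mul_le_mul_of_nonneg_right (le_max_left _ _) (hlc k hk)
        · exact mul_le_mul_of_nonneg_right (le_max_right _ _) (hlc k hk)) hε
    exact Moran.liminf_limsup_of_subseq (fun ε hε => (hev ε hε).mono fun _ hx => hx.1)
      (fun ε hε => (hev ε hε).mono fun _ hx => hx.2) huo hut (hAB s).1 (hAB s).2
  · rintro ⟨L, hL⟩
    exact hne ((tendsto_nhds_unique (hAB s).1 (hL.comp huo)).trans
      (tendsto_nhds_unique (hL.comp hut) (hAB s).2))
end
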